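/- Let R = ∏_{i=1}^m R_i and R' = ∏_{j=1}^{m'} R'_j with R_i = End_{K_i}(U_i), R'_j = End_{K'_j}(U'_j), where all U_i, U'_j are left vector spaces over fields with 1 ≤ dim U_i, dim U'_j < ∞. Let 𝔐 and 𝔐' be the associated product spaces with point sets 𝒢, 𝒢' and canonical bijections Ψ: ℙ(R) → 𝒢, Ψ': ℙ(R') → 𝒢'. For a mapping φ: ℙ(R) → ℙ(R'), the following are equivalent: (1) φ is a △-isomorphism; (2) φ is a ∼-isomorphism; (3) the map 𝒢 → 𝒢' given by X ↦ Ψ'(φ(Ψ⁻¹(X))) is a collineation of 𝔐 onto 𝔐'. -/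

import Mathlib

/-- `p` is a point of the projective line over `R`. -/
def IsPoint (R : Type*) [Ring R] (p : Submodule R (R × R)) : Prop :=
  ∃ g : (Matrix (Fin 2) (Fin 2) R)ˣ,
    p = Submodule.span R {(g.val 0 0, g.val 0 1)}

/-- distant relation -/
def Distant {R : Type*} [Ring R] (p q : Submodule R (R × R)) : Prop :=
  ∃ g : (Matrix (Fin 2) (Fin 2) R)ˣ,
    p = Submodule.span R {(g.val 0 0, g.val 0 1)} ∧
    q = Submodule.span R {(g.val 1 0, g.val 1 1)}

/-- `△(p)`: the set of points distant to `p`. -/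
def DistantSet {R : Type*} [Ring R] (p : Submodule R (R × R)) :
    Set (Submodule R (R × R)) := {x | Distant x p}

/-- `p ∥ q` iff `△(p) ⊆ △(q)`. -/
def Parallel {R : Type*} [Ring R] (p q : Submodule R (R × R)) : Prop :=
  DistantSet p ⊆ DistantSet q

/-- `p ∼ q` via `r`: `r ∦ p`, `r ∦ q` and `△(r) ⊆ △(p) ∪ △(q)`. -/
def AdjacentVia {R : Type*} [Ring R] (p q r : Submodule R (R × R)) : Prop :=
  ¬ Parallel r p ∧ ¬ Parallel r q ∧ DistantSet r ⊆ DistantSet p ∪ DistantSet q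

/-- `p ∼ q`: there is a point `r` with `p ∼ q` via `r`. -/
def Adjacent {R : Type*} [Ring R] (p q : Submodule R (R × R)) : Prop :=
  ∃ r, IsPoint R r ∧ AdjacentVia p q r

open MulOpposite

/-- `End_K(U)` with endomorphisms written on the right, as in the paper. -/
abbrev EndOp (K U : Type*) [DivisionRing K] [AddCommGroup U] [Module K U] :=
  (Module.End K U)ᵐᵒᵖ

/-- The projective line over `R` (as a type). -/
abbrev PL (R : Type*) [Ring R] := {p : Submodule R (R × R) // IsPoint R p}

/-- The point set of the product (Segre) space `Π 𝔐_i` of the Grassmann spaces `𝔐_i`: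
families of `(dim U_i)`-dimensional subspaces of `U_i × U_i`. -/
abbrev SegrePts {I : Type*} (K U : I → Type*) [∀ i, DivisionRing (K i)]
    [∀ i, AddCommGroup (U i)] [∀ i, Module (K i) (U i)] :=
  {X : ∀ i, Submodule (K i) (U i × U i) //
    ∀ i, Module.finrank (K i) (X i) = Module.finrank (K i) (U i)}

/-- Lines of the product (Segre) space: one coordinate runs over a pencil of the
corresponding Grassmann space, all other coordinates are fixed. -/
def IsSegreLine {I : Type*} {K U : I → Type*} [∀ i, DivisionRing (K i)]
    [∀ i, AddCommGroup (U i)] [∀ i, Module (K i) (U i)]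
    (L : Set (SegrePts K U)) : Prop :=
  ∃ (j : I) (M N : Submodule (K j) (U j × U j)) (C : SegrePts K U),
    Module.finrank (K j) M = Module.finrank (K j) (U j) - 1 ∧
    Module.finrank (K j) N = Module.finrank (K j) (U j) + 1 ∧ M < N ∧
    L = {X | (∀ i, i ≠ j → X.1 i = C.1 i) ∧ M < X.1 j ∧ X.1 j < N}

/-- A collineation between Segre products of Grassmann spaces: a bijection of the point
sets mapping lines onto lines in both directions. -/
def IsSegreCollineation {I I' : Type*} {K U : I → Type*} {K' U' : I' → Type*}
    [∀ i, DivisionRing (K i)] [∀ i, AddCommGroup (U i)] [∀ i, Module (K i) (U i)]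
    [∀ i, DivisionRing (K' i)] [∀ i, AddCommGroup (U' i)] [∀ i, Module (K' i) (U' i)]
    (g : SegrePts K U → SegrePts K' U') : Prop :=
  Function.Bijective g ∧ (∀ L, IsSegreLine L → IsSegreLine (g '' L)) ∧
    (∀ L', IsSegreLine L' → IsSegreLine (g ⁻¹' L'))

section Grassmann

open Module

variable {K V : Type*} [DivisionRing K] [AddCommGroup V] [Module K V]

/-- A vector outside `Z` lies in some complement of `Z`. -/
lemma Submodule.exists_isCompl_mem {Z : Submodule K V} {x : V} (hx : x ∉ Z) :
    ∃ W : Submodule K V, IsCompl W Z ∧ x ∈ W := by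
  obtain ⟨W, hW, hc⟩ := (Submodule.disjoint_span_singleton_of_notMem hx).symm.exists_isCompl
  exact ⟨W, hc, hW (Submodule.mem_span_singleton_self x)⟩

lemma Submodule.not_disjoint_of_mem {X W : Submodule K V} {x : V} (hX : x ∈ X) (hW : x ∈ W)
    (hx : x ≠ 0) : ¬ Disjoint W X := fun h => hx (Submodule.disjoint_def.1 h x hW hX)

variable [FiniteDimensional K V]

lemma Submodule.exists_mem_notMem_of_finrank_eq {X Y : Submodule K V}
    (h : finrank K X = finrank K Y) (hne : X ≠ Y) : ∃ x ∈ X, x ∉ Y :=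
  SetLike.not_le_iff_exists.1 fun hle => hne (Submodule.eq_of_le_of_finrank_eq hle h)

lemma Submodule.exists_isCompl_not_disjoint {X Z : Submodule K V}
    (h : finrank K X = finrank K Z) (hne : X ≠ Z) :
    ∃ W : Submodule K V, IsCompl W Z ∧ ¬ Disjoint W X := by
  obtain ⟨x, hx, hxZ⟩ := Submodule.exists_mem_notMem_of_finrank_eq h hne
  obtain ⟨W, hc, hxW⟩ := Submodule.exists_isCompl_mem hxZ
  exact ⟨W, hc, Submodule.not_disjoint_of_mem hx hxW fun h0 => hxZ (h0 ▸ Z.zero_mem)⟩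

/-- If every complement of `Z` avoids `X` or `Y`, then `X`, `Y`, `Z` lie in a common pencil. -/
lemma Submodule.pencil_of_forall_isCompl {X Y Z : Submodule K V}
    (hX : finrank K X = finrank K Z) (hY : finrank K Y = finrank K Z) (hXZ : X ≠ Z) (hYZ : Y ≠ Z)
    (h : ∀ W, IsCompl W Z → Disjoint W X ∨ Disjoint W Y) :
    X ⊔ Z = Y ⊔ Z ∧ X ⊓ Z = Y ⊓ Z ∧ finrank K (X ⊔ Z : Submodule K V) = finrank K Z + 1 := by
  have key : ∀ x ∈ X, x ∉ Z → ∀ y ∈ Y, y ∉ Z → ∃ c : K, y - c • x ∈ Z := by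
    intro x hx hxZ y hy hyZ
    by_contra! hc
    have hd : Disjoint (Submodule.span K {x, y}) Z := by
      rw [Submodule.disjoint_def]
      intro v hv hvZ
      obtain ⟨s, t, rfl⟩ := Submodule.mem_span_pair.1 hv
      by_cases ht : t = 0
      · subst ht
        by_cases hs : s = 0
        · simp [hs]
        · rw [zero_smul, add_zero] at hvZ
          exact absurd ((Submodule.smul_mem_iff Z hs).1 hvZ) hxZ
      · refine absurd ?_ (hc (-(t⁻¹ * s)))
        have := Z.smul_mem t⁻¹ hvZ
        rwa [smul_add, smul_smul, smul_smul, inv_mul_cancel₀ ht, one_smul, add_comm,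
          ← sub_neg_eq_add, ← neg_smul] at this
    obtain ⟨W, hW, hWZ⟩ := hd.exists_isCompl
    rcases h W hWZ with h1 | h1
    · exact Submodule.not_disjoint_of_mem hx (hW (Submodule.subset_span (by simp)))
        (fun h0 => hxZ (h0 ▸ Z.zero_mem)) h1
    · exact Submodule.not_disjoint_of_mem hy (hW (Submodule.subset_span (by simp)))
        (fun h0 => hyZ (h0 ▸ Z.zero_mem)) h1
  obtain ⟨x₀, hx₀, hx₀Z⟩ := Submodule.exists_mem_notMem_of_finrank_eq hX hXZ
  obtain ⟨y₀, hy₀, hy₀Z⟩ := Submodule.exists_mem_notMem_of_finrank_eq hY hYZ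
  have memN : ∀ (c : K) (v : V), v - c • x₀ ∈ Z → v ∈ Z ⊔ Submodule.span K {x₀} := by
    intro c v hv
    rw [← sub_add_cancel v (c • x₀)]
    exact Submodule.add_mem_sup hv (Submodule.smul_mem _ _ (Submodule.mem_span_singleton_self _))
  have hN : finrank K (Z ⊔ Submodule.span K {x₀} : Submodule K V) = finrank K Z + 1 :=
    Submodule.finrank_sup_span_singleton hx₀Z
  have hYN : Y ⊔ Z ≤ Z ⊔ Submodule.span K {x₀} := by
    refine sup_le (fun y hy => ?_) le_sup_left
    by_cases hyZ : y ∈ Z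
    · exact Submodule.mem_sup_left hyZ
    · obtain ⟨c, hc⟩ := key x₀ hx₀ hx₀Z y hy hyZ
      exact memN c y hc
  have hXN : X ⊔ Z ≤ Z ⊔ Submodule.span K {x₀} := by
    refine sup_le (fun x hx => ?_) le_sup_left
    by_cases hxZ : x ∈ Z
    · exact Submodule.mem_sup_left hxZ
    · obtain ⟨c, hc⟩ := key x hx hxZ y₀ hy₀ hy₀Z
      have hc0 : c ≠ 0 := by
        rintro rfl
        simp [hy₀Z] at hc
      have hy₀N : y₀ ∈ Z ⊔ Submodule.span K {x₀} := hYN (Submodule.mem_sup_left hy₀)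
      refine (Submodule.smul_mem_iff _ hc0).1 ?_
      have := Submodule.sub_mem _ hy₀N (Submodule.mem_sup_left hc)
      rwa [sub_sub_cancel] at this
  have full : ∀ A : Submodule K V, A ⊔ Z ≤ Z ⊔ Submodule.span K {x₀} → ¬ A ≤ Z →
      A ⊔ Z = Z ⊔ Submodule.span K {x₀} := by
    intro A hA hAZ
    refine Submodule.eq_of_le_of_finrank_le hA ?_
    rw [hN]
    exact Submodule.finrank_lt_finrank_of_lt (right_lt_sup.2 hAZ)
  have eX := full X hXN fun hle => hx₀Z (hle hx₀)
  have eY := full Y hYN fun hle => hy₀Z (hle hy₀)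
  refine ⟨eX.trans eY.symm, ?_, by rw [eX, hN]⟩
  by_contra hne
  have d1 := Submodule.finrank_sup_add_finrank_inf_eq X Z
  have d2 := Submodule.finrank_sup_add_finrank_inf_eq Y Z
  rw [eX, hN] at d1
  rw [eY, hN] at d2
  have hsup : X ⊓ Z ⊔ Y ⊓ Z = Z := by
    refine Submodule.eq_of_le_of_finrank_le (sup_le inf_le_right inf_le_right) ?_
    have : X ⊓ Z < X ⊓ Z ⊔ Y ⊓ Z := left_lt_sup.2 fun hle =>
      hne (Submodule.eq_of_le_of_finrank_eq hle (by omega)).symm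
    have := Submodule.finrank_lt_finrank_of_lt this
    omega
  obtain ⟨c, hc⟩ := key x₀ hx₀ hx₀Z y₀ hy₀ hy₀Z
  rw [← hsup] at hc
  obtain ⟨a, ha, b, hb, hab⟩ := Submodule.mem_sup.1 hc
  have hwX : y₀ - b ∈ X := by
    have : y₀ - b = a + c • x₀ := by
      rw [eq_sub_iff_add_eq] at hab
      rw [← hab]; abel
    rw [this]
    exact X.add_mem ha.1 (X.smul_mem _ hx₀)
  have hwY : y₀ - b ∈ Y := Y.sub_mem hy₀ hb.1
  have hwZ : y₀ - b ∉ Z := fun hw => hy₀Z ((Submodule.sub_mem_iff_left Z hb.2).1 hw)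
  obtain ⟨W, hWZ, hwW⟩ := Submodule.exists_isCompl_mem hwZ
  have hw0 : y₀ - b ≠ 0 := fun h0 => hwZ (h0 ▸ Z.zero_mem)
  exact (h W hWZ).elim (Submodule.not_disjoint_of_mem hwX hwW hw0)
    (Submodule.not_disjoint_of_mem hwY hwW hw0)

/-- Two members of a pencil determine its base and its top. -/
lemma Submodule.eq_inf_and_eq_sup_of_pencil {n : ℕ} {M N X Y : Submodule K V}
    (hM : finrank K M = n - 1) (hN : finrank K N = n + 1) (hX : finrank K X = n)
    (hY : finrank K Y = n) (hne : X ≠ Y) (hMX : M < X) (hXN : X < N) (hMY : M < Y) (hYN : Y < N) :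
    M = X ⊓ Y ∧ N = X ⊔ Y := by
  have hlt : X ⊓ Y < X := inf_lt_left.2 fun hle =>
    hne (Submodule.eq_of_le_of_finrank_eq hle (by omega))
  have hlt' : X < X ⊔ Y := left_lt_sup.2 fun hle =>
    hne (Submodule.eq_of_le_of_finrank_eq hle (by omega)).symm
  have := Submodule.finrank_lt_finrank_of_lt hlt
  have := Submodule.finrank_lt_finrank_of_lt hlt'
  exact ⟨Submodule.eq_of_le_of_finrank_le (le_inf hMX.le hMY.le) (by omega),
    (Submodule.eq_of_le_of_finrank_le (sup_le hXN.le hYN.le) (by omega)).symm⟩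

lemma Submodule.disjoint_or_disjoint_of_pencil {n : ℕ} {M N X Y Z W : Submodule K V}
    (hM : finrank K M = n - 1) (hN : finrank K N = n + 1) (hX : finrank K X = n)
    (hY : finrank K Y = n) (hZ : finrank K Z = n) (hne : X ≠ Y)
    (hMX : M < X) (hXN : X < N) (hMY : M < Y) (hYN : Y < N) (hMZ : M < Z) (hZN : Z < N)
    (hW : IsCompl W Z) : Disjoint W X ∨ Disjoint W Y := by
  by_contra! hcon
  have ex : ∀ A : Submodule K V, ¬ Disjoint W A → ∃ w ∈ W, w ∈ A ∧ w ≠ 0 := by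
    intro A hA
    simpa [Submodule.disjoint_def] using hA
  obtain ⟨w, hwW, hwX, hw0⟩ := ex X hcon.1
  obtain ⟨v, hvW, hvY, hv0⟩ := ex Y hcon.2
  have hd := Submodule.disjoint_def.1 hW.disjoint
  have hwZ : w ∉ Z := fun h => hw0 (hd w hwW h)
  have hvZ : v ∉ Z := fun h => hv0 (hd v hvW h)
  have hNe : Z ⊔ Submodule.span K {w} = N :=
    Submodule.eq_of_le_of_finrank_eq
      (sup_le hZN.le ((Submodule.span_singleton_le_iff_mem _ _).2 (hXN.le hwX)))
      (by rw [Submodule.finrank_sup_span_singleton hwZ]; omega)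
  obtain ⟨z, hz, u, hu, huv⟩ := Submodule.mem_sup.1 (hNe ▸ hYN.le hvY)
  obtain ⟨c, rfl⟩ := Submodule.mem_span_singleton.1 hu
  have hz0 : z = 0 := hd z (by
    rw [eq_sub_of_add_eq huv]
    exact W.sub_mem hvW (W.smul_mem _ hwW)) hz
  rw [hz0, zero_add] at huv
  have hMe := (Submodule.eq_inf_and_eq_sup_of_pencil hM hN hX hY hne hMX hXN hMY hYN).1
  have : v ∈ M := by
    rw [hMe]
    exact ⟨huv ▸ X.smul_mem c hwX, hvY⟩
  exact hvZ (hMZ.le this)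

/-- A pencil has at least three members. -/
lemma Submodule.exists_third_of_pencil {n : ℕ} {M N X Y : Submodule K V}
    (hM : finrank K M = n - 1) (hN : finrank K N = n + 1) (hX : finrank K X = n)
    (hY : finrank K Y = n) (hne : X ≠ Y) (hMX : M < X) (hXN : X < N) (hYN : Y < N) :
    ∃ Z : Submodule K V, finrank K Z = n ∧ M < Z ∧ Z < N ∧ Z ≠ X ∧ Z ≠ Y := by
  obtain ⟨x, hxX, hxY⟩ := Submodule.exists_mem_notMem_of_finrank_eq (hX.trans hY.symm) hne
  obtain ⟨y, hyY, hyX⟩ := Submodule.exists_mem_notMem_of_finrank_eq (hY.trans hX.symm) hne.symm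
  have h1 : x + y ∉ X := fun h => hyX ((Submodule.add_mem_iff_right X hxX).1 h)
  have h2 : x + y ∉ Y := fun h => hxY ((Submodule.add_mem_iff_left Y hyY).1 h)
  have hmem : x + y ∈ M ⊔ Submodule.span K {x + y} :=
    Submodule.mem_sup_right (Submodule.mem_span_singleton_self _)
  have hMn := Submodule.finrank_lt_finrank_of_lt hMX
  have hf : finrank K (M ⊔ Submodule.span K {x + y} : Submodule K V) = n := by
    rw [Submodule.finrank_sup_span_singleton fun h => h1 (hMX.le h)]
    omega
  refine ⟨M ⊔ Submodule.span K {x + y}, hf, ?_, ?_, fun h => h1 (h ▸ hmem), fun h => h2 (h ▸ hmem)⟩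
  · refine lt_of_le_of_ne le_sup_left fun h => h1 (hMX.le ?_)
    rw [h]; exact hmem
  · refine lt_of_le_of_ne (sup_le (hMX.le.trans hXN.le)
      ((Submodule.span_singleton_le_iff_mem _ _).2 (N.add_mem (hXN.le hxX) (hYN.le hyY)))) fun h => ?_
    rw [h] at hf
    omega

/-- A pencil has at least two members. -/
lemma Submodule.exists_two_of_pencil {n : ℕ} {M N : Submodule K V}
    (hn : 1 ≤ n) (hM : finrank K M = n - 1) (hN : finrank K N = n + 1) (hMN : M < N) :
    ∃ X Y : Submodule K V, finrank K X = n ∧ finrank K Y = n ∧ X ≠ Y ∧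
      M < X ∧ X < N ∧ M < Y ∧ Y < N := by
  have step : ∀ A : Submodule K V, finrank K A ≤ n → M ≤ A → A ≤ N → ∃ X : Submodule K V,
      finrank K X = n ∧ M < X ∧ X < N ∧ ¬ X ≤ A := by
    intro A hA hMA hAN
    obtain ⟨x, hxN, hxA⟩ := SetLike.exists_of_lt (lt_of_le_of_ne hAN fun h => by
      rw [h] at hA; omega)
    have hxM : x ∉ M := fun h => hxA (hMA h)
    have hf : finrank K (M ⊔ Submodule.span K {x} : Submodule K V) = n := by
      rw [Submodule.finrank_sup_span_singleton hxM]
      omega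
    have hmem : x ∈ M ⊔ Submodule.span K {x} :=
      Submodule.mem_sup_right (Submodule.mem_span_singleton_self _)
    refine ⟨M ⊔ Submodule.span K {x}, hf, lt_of_le_of_ne le_sup_left fun h => hxM ?_,
      lt_of_le_of_ne (sup_le hMN.le ((Submodule.span_singleton_le_iff_mem _ _).2 hxN)) fun h => ?_,
      fun h => hxA (h hmem)⟩
    · rw [h]; exact hmem
    · rw [h] at hf; omega
  obtain ⟨X, hX, hMX, hXN, -⟩ := step M (by omega) le_rfl hMN.le
  obtain ⟨Y, hY, hMY, hYN, hYX⟩ := step X hX.le hMX.le hXN.le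
  exact ⟨X, Y, hX, hY, fun h => hYX h.ge, hMX, hXN, hMY, hYN⟩

/-- Inside a suitable pencil one can move from `X` one step closer to `Y`. -/
lemma Submodule.exists_pencil_closer {n : ℕ} {X Y : Submodule K V}
    (hX : finrank K X = n) (hY : finrank K Y = n) (hne : X ≠ Y) :
    ∃ M N X' : Submodule K V, finrank K M = n - 1 ∧ finrank K N = n + 1 ∧ finrank K X' = n ∧
      M < X ∧ X < N ∧ M < X' ∧ X' < N ∧ X' ≠ X ∧
      finrank K (X ⊓ Y : Submodule K V) + 1 ≤ finrank K (X' ⊓ Y : Submodule K V) := by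
  obtain ⟨x, hxX, hxY⟩ := Submodule.exists_mem_notMem_of_finrank_eq (hX.trans hY.symm) hne
  obtain ⟨y, hyY, hyX⟩ := Submodule.exists_mem_notMem_of_finrank_eq (hY.trans hX.symm) hne.symm
  obtain ⟨W, hle, hW⟩ := (Submodule.disjoint_span_singleton_of_notMem
    (fun h : x ∈ X ⊓ Y => hxY h.2)).exists_isCompl
  have hsX : Submodule.span K {x} ≤ X := (Submodule.span_singleton_le_iff_mem _ _).2 hxX
  have hxM : x ∉ W ⊓ X := fun h => hxY (by
    rw [Submodule.disjoint_def.1 hW.disjoint x h.1 (Submodule.mem_span_singleton_self x)]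
    exact Y.zero_mem)
  have hsup : W ⊓ X ⊔ Submodule.span K {x} = X := by
    rw [sup_comm, ← sup_inf_assoc_of_le W hsX, sup_comm, hW.sup_eq_top, top_inf_eq]
  have hMf := Submodule.finrank_sup_span_singleton (K := K) hxM
  rw [hsup, hX] at hMf
  have hyM : y ∉ W ⊓ X := fun h => hyX h.2
  have hmem : ∀ A : Submodule K V, y ∈ A ⊔ Submodule.span K {y} := fun A =>
    Submodule.mem_sup_right (Submodule.mem_span_singleton_self _)
  refine ⟨W ⊓ X, X ⊔ Submodule.span K {y}, W ⊓ X ⊔ Submodule.span K {y}, by omega, ?_, ?_,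
    lt_of_le_of_ne inf_le_right fun h => hxM ?_,
    lt_of_le_of_ne le_sup_left fun h => hyX ?_,
    lt_of_le_of_ne le_sup_left fun h => hyM ?_,
    lt_of_le_of_ne (sup_le_sup_right inf_le_right _) fun h => ?_,
    fun h => hyX (h ▸ hmem _), ?_⟩
  · rw [Submodule.finrank_sup_span_singleton hyX, hX]
  · rw [Submodule.finrank_sup_span_singleton hyM]; omega
  · rw [h]; exact hxX
  · rw [h]; exact hmem _
  · rw [h]; exact hmem _
  · have h1 := Submodule.finrank_sup_span_singleton (K := K) hyX
    have h2 := Submodule.finrank_sup_span_singleton (K := K) hyM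
    rw [h] at h2
    omega
  · rw [← Submodule.finrank_sup_span_singleton (K := K) (fun h : y ∈ X ⊓ Y => hyX h.1)]
    refine Submodule.finrank_mono (le_inf ?_ ?_)
    · exact sup_le_sup_right (le_inf hle inf_le_left) _
    · exact sup_le inf_le_right ((Submodule.span_singleton_le_iff_mem _ _).2 hyY)

lemma Submodule.finrank_inf_le_of_pencil {n : ℕ} {M X X' : Submodule K V} (Y : Submodule K V)
    (hM : finrank K M = n - 1) (hX : finrank K X = n) (hMX : M < X) (hMX' : M < X') :
    finrank K (X ⊓ Y : Submodule K V) ≤ finrank K (X' ⊓ Y : Submodule K V) + 1 := by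
  have h1 := Submodule.finrank_sup_add_finrank_inf_eq M (X ⊓ Y)
  have h2 : finrank K (M ⊔ X ⊓ Y : Submodule K V) ≤ n :=
    hX ▸ Submodule.finrank_mono (sup_le hMX.le inf_le_left)
  have h3 : finrank K (M ⊓ (X ⊓ Y) : Submodule K V) ≤ finrank K (X' ⊓ Y : Submodule K V) :=
    Submodule.finrank_mono (le_inf (inf_le_left.trans hMX'.le) (inf_le_right.trans inf_le_right))
  omega

end Grassmann

section Segre

open Module

/-- `p` and `q` are adjacent via `r` with respect to an arbitrary relation in place of `△`. -/
def RelVia {P : Type*} (opp : P → P → Prop) (p q r : P) : Prop :=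
  ¬ (∀ x, opp x r → opp x p) ∧ ¬ (∀ x, opp x r → opp x q) ∧
    ∀ x, opp x r → opp x p ∨ opp x q

lemma relVia_equiv_iff {P P' : Type*} {opp : P → P → Prop} {opp' : P' → P' → Prop} (e : P ≃ P')
    (h : ∀ x y, opp x y ↔ opp' (e x) (e y)) (p q r : P) :
    RelVia opp' (e p) (e q) (e r) ↔ RelVia opp p q r := by
  simp only [RelVia, e.surjective.forall, h]

variable {I : Type*} {K U : I → Type*} [∀ i, DivisionRing (K i)]
    [∀ i, AddCommGroup (U i)] [∀ i, Module (K i) (U i)]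

/-- Componentwise complementary families of subspaces. -/
def SegreOpp (X Y : SegrePts K U) : Prop := ∀ i, IsCompl (X.1 i) (Y.1 i)

/-- Different points on a common line. -/
def SegreCollinear (X Y : SegrePts K U) : Prop :=
  X ≠ Y ∧ ∃ L : Set (SegrePts K U), IsSegreLine L ∧ X ∈ L ∧ Y ∈ L

lemma SegrePts.exists_ne {X Y : SegrePts K U} (h : X ≠ Y) : ∃ i, X.1 i ≠ Y.1 i := by
  by_contra! hc
  exact h (Subtype.ext (funext hc))

lemma SegrePts.exists_update (C : SegrePts K U) (j : I) (A : Submodule (K j) (U j × U j))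
    (hA : finrank (K j) A = finrank (K j) (U j)) :
    ∃ X : SegrePts K U, X.1 j = A ∧ ∀ i, i ≠ j → X.1 i = C.1 i := by
  classical
  refine ⟨⟨Function.update C.1 j A, fun i => ?_⟩, by simp, fun i hi => by simp [hi]⟩
  by_cases hi : i = j
  · subst hi; rw [Function.update_self]; exact hA
  · rw [Function.update_of_ne hi]; exact C.2 i

/-- The distance of two points in the collinearity graph of the product space. -/
noncomputable def segreDist [Fintype I] (X Y : SegrePts K U) : ℕ :=
  ∑ i, (finrank (K i) (U i) - finrank (K i) (X.1 i ⊓ Y.1 i : Submodule (K i) (U i × U i)))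

lemma segreDist_le_sum [Fintype I] (X Y : SegrePts K U) : segreDist X Y ≤ ∑ i, finrank (K i) (U i) :=
  Finset.sum_le_sum fun _ _ => Nat.sub_le _ _

lemma nonempty_segrePts : Nonempty (SegrePts K U) := by
  refine ⟨⟨fun i => LinearMap.range (LinearMap.inl (K i) (U i) (U i)), fun i => ?_⟩⟩
  exact LinearMap.finrank_range_of_inj LinearMap.inl_injective

variable [∀ i, FiniteDimensional (K i) (U i)]

lemma SegrePts.finrank_inf_le (X Y : SegrePts K U) (i : I) :
    finrank (K i) (X.1 i ⊓ Y.1 i : Submodule (K i) (U i × U i)) ≤ finrank (K i) (U i) :=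
  X.2 i ▸ Submodule.finrank_mono inf_le_left

lemma SegrePts.finrank_of_isCompl (Z : SegrePts K U) {i : I} {W : Submodule (K i) (U i × U i)}
    (hW : IsCompl W (Z.1 i)) : finrank (K i) W = finrank (K i) (U i) := by
  have h1 := Submodule.finrank_add_eq_of_isCompl hW
  have h2 := Z.2 i
  rw [finrank_prod] at h1
  omega

lemma SegrePts.isCompl_iff_disjoint (X Y : SegrePts K U) (i : I) :
    IsCompl (X.1 i) (Y.1 i) ↔ Disjoint (X.1 i) (Y.1 i) :=
  Submodule.isCompl_iff_disjoint _ _ (by rw [X.2 i, Y.2 i, finrank_prod])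

lemma SegrePts.exists_opp_of_forall (Z : SegrePts K U)
    {P : ∀ i, Submodule (K i) (U i × U i) → Prop}
    (h : ∀ i, ∃ W, IsCompl W (Z.1 i) ∧ P i W) :
    ∃ W : SegrePts K U, SegreOpp W Z ∧ ∀ i, P i (W.1 i) := by
  choose W hW hP using h
  exact ⟨⟨W, fun i => Z.finrank_of_isCompl (hW i)⟩, hW, hP⟩

lemma SegrePts.exists_opp (Z : SegrePts K U) : ∃ W : SegrePts K U, SegreOpp W Z := by
  obtain ⟨W, hW, -⟩ := Z.exists_opp_of_forall (P := fun _ _ => True) fun i => by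
    obtain ⟨W, hW⟩ := exists_isCompl (Z.1 i)
    exact ⟨W, hW.symm, trivial⟩
  exact ⟨W, hW⟩

/-- A point is determined by the set of its opposite points. -/
lemma SegrePts.eq_of_forall_opp {X Z : SegrePts K U} (h : ∀ W, SegreOpp W Z → SegreOpp W X) :
    X = Z := by
  by_contra hne
  obtain ⟨j, hj⟩ := SegrePts.exists_ne hne
  obtain ⟨W, hW, hWX⟩ := Z.exists_opp_of_forall
    (P := fun i W => i = j → ¬ Disjoint W (X.1 i)) fun i => by
      by_cases hi : i = j
      · subst hi
        obtain ⟨W, hW, hWX⟩ := Submodule.exists_isCompl_not_disjoint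
          ((X.2 i).trans (Z.2 i).symm) hj
        exact ⟨W, hW, fun _ => hWX⟩
      · obtain ⟨W, hW⟩ := exists_isCompl (Z.1 i)
        exact ⟨W, hW.symm, fun h => absurd h hi⟩
  exact hWX j rfl (h W hW j).disjoint

lemma SegrePts.eq_index_of_forall_opp {X Y Z : SegrePts K U}
    (h : ∀ W, SegreOpp W Z → SegreOpp W X ∨ SegreOpp W Y) {j k : I}
    (hj : X.1 j ≠ Z.1 j) (hk : Y.1 k ≠ Z.1 k) : k = j := by
  by_contra hkj
  obtain ⟨W, hW, hWX⟩ := Z.exists_opp_of_forall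
    (P := fun i W => (i = j → ¬ Disjoint W (X.1 i)) ∧ (i = k → ¬ Disjoint W (Y.1 i))) fun i => by
      by_cases hi : i = j
      · subst hi
        obtain ⟨W, hW, hWX⟩ := Submodule.exists_isCompl_not_disjoint
          ((X.2 i).trans (Z.2 i).symm) hj
        exact ⟨W, hW, fun _ => hWX, fun h => absurd h.symm hkj⟩
      · by_cases hi' : i = k
        · subst hi'
          obtain ⟨W, hW, hWY⟩ := Submodule.exists_isCompl_not_disjoint
            ((Y.2 i).trans (Z.2 i).symm) hk
          exact ⟨W, hW, fun h => absurd h hi, fun _ => hWY⟩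
        · obtain ⟨W, hW⟩ := exists_isCompl (Z.1 i)
          exact ⟨W, hW.symm, fun h => absurd h hi, fun h => absurd h hi'⟩
  rcases h W hW with h1 | h1
  · exact (hWX j).1 rfl (h1 j).disjoint
  · exact (hWX k).2 rfl (h1 k).disjoint

/-- The relation `RelVia SegreOpp` means being pairwise distinct points on a line. -/
lemma relVia_segreOpp_iff {X Y Z : SegrePts K U} :
    RelVia SegreOpp X Y Z ↔ X ≠ Y ∧ Z ≠ X ∧ Z ≠ Y ∧
      ∃ L : Set (SegrePts K U), IsSegreLine L ∧ X ∈ L ∧ Y ∈ L ∧ Z ∈ L := by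
  constructor
  · rintro ⟨hX, hY, h⟩
    have hXZ : X ≠ Z := fun e => hX fun _ hx => e ▸ hx
    have hYZ : Y ≠ Z := fun e => hY fun _ hx => e ▸ hx
    have hXY : X ≠ Y := by
      rintro rfl
      exact hX fun x hx => (h x hx).elim id id
    refine ⟨hXY, hXZ.symm, hYZ.symm, ?_⟩
    obtain ⟨j, hj⟩ := SegrePts.exists_ne hXZ
    obtain ⟨k, hk⟩ := SegrePts.exists_ne hYZ
    obtain rfl := SegrePts.eq_index_of_forall_opp h hj hk
    have eY : ∀ i, i ≠ k → Y.1 i = Z.1 i := fun i hi => by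
      by_contra hc
      exact hi (SegrePts.eq_index_of_forall_opp h hj hc)
    have eX : ∀ i, i ≠ k → X.1 i = Z.1 i := fun i hi => by
      by_contra hc
      exact hi (SegrePts.eq_index_of_forall_opp h hc hk).symm
    obtain ⟨W₀, hW₀⟩ := Z.exists_opp
    obtain ⟨hsup, hinf, hN⟩ := Submodule.pencil_of_forall_isCompl
      ((X.2 k).trans (Z.2 k).symm) ((Y.2 k).trans (Z.2 k).symm) hj hk fun A hA => by
        obtain ⟨W, hWk, hW⟩ := W₀.exists_update k A (Z.finrank_of_isCompl hA)
        have hWZ : SegreOpp W Z := fun i => by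
          by_cases hi : i = k
          · subst hi; rwa [hWk]
          · rw [hW i hi]; exact hW₀ i
        rw [← hWk]
        exact (h W hWZ).imp (fun h1 => (h1 k).disjoint) (fun h1 => (h1 k).disjoint)
    have d := Submodule.finrank_sup_add_finrank_inf_eq (X.1 k) (Z.1 k)
    have dX := X.2 k
    have dY := Y.2 k
    have dZ := Z.2 k
    have hM : finrank (K k) (X.1 k ⊓ Z.1 k : Submodule (K k) (U k × U k)) + 1 =
        finrank (K k) (U k) := by omega
    have hN' : finrank (K k) (X.1 k ⊔ Z.1 k : Submodule (K k) (U k × U k)) =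
        finrank (K k) (U k) + 1 := by omega
    have lt : ∀ A : Submodule (K k) (U k × U k), finrank (K k) A = finrank (K k) (U k) →
        X.1 k ⊓ Z.1 k ≤ A → A ≤ X.1 k ⊔ Z.1 k → X.1 k ⊓ Z.1 k < A ∧ A < X.1 k ⊔ Z.1 k := by
      refine fun A hA h1 h2 => ⟨lt_of_le_of_ne h1 fun h => ?_, lt_of_le_of_ne h2 fun h => ?_⟩
      · rw [h] at hM; omega
      · rw [← h] at hN'; omega
    have hltX := lt _ dX inf_le_left le_sup_left
    exact ⟨_, ⟨k, X.1 k ⊓ Z.1 k, X.1 k ⊔ Z.1 k, Z, by omega, hN', hltX.1.trans hltX.2, rfl⟩,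
      ⟨eX, hltX⟩, ⟨eY, lt _ dY (hinf ▸ inf_le_left) (hsup ▸ le_sup_left)⟩,
      ⟨fun _ _ => rfl, lt _ dZ inf_le_right le_sup_right⟩⟩
  · rintro ⟨hXY, hZX, hZY, L, ⟨j, M, N, C, hM, hN, -, rfl⟩, hX, hY, hZ⟩
    refine ⟨fun h => hZX (SegrePts.eq_of_forall_opp h).symm,
      fun h => hZY (SegrePts.eq_of_forall_opp h).symm, fun W hW => ?_⟩
    have hne : X.1 j ≠ Y.1 j := fun e => hXY <| Subtype.ext <| funext fun i => by
      by_cases hi : i = j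
      · subst hi; exact e
      · rw [hX.1 i hi, hY.1 i hi]
    have lift : ∀ A : SegrePts K U, (∀ i, i ≠ j → A.1 i = C.1 i) → Disjoint (W.1 j) (A.1 j) →
        SegreOpp W A := fun A hA hd i => by
      by_cases hi : i = j
      · subst hi; exact (SegrePts.isCompl_iff_disjoint _ _ _).2 hd
      · rw [hA i hi, ← hZ.1 i hi]; exact hW i
    exact (Submodule.disjoint_or_disjoint_of_pencil hM hN (X.2 j) (Y.2 j) (Z.2 j) hne
      hX.2.1 hX.2.2 hY.2.1 hY.2.2 hZ.2.1 hZ.2.2 (hW j)).imp (lift X hX.1) (lift Y hY.1)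

/-- Two distinct points lie on at most one line. -/
lemma IsSegreLine.eq_of_mem {L L' : Set (SegrePts K U)} (hL : IsSegreLine L)
    (hL' : IsSegreLine L') {X Y : SegrePts K U} (hXY : X ≠ Y) (hX : X ∈ L) (hY : Y ∈ L)
    (hX' : X ∈ L') (hY' : Y ∈ L') : L = L' := by
  obtain ⟨j, M, N, C, hM, hN, -, rfl⟩ := hL
  obtain ⟨k, M', N', C', hM', hN', -, rfl⟩ := hL'
  obtain ⟨i, hi⟩ := SegrePts.exists_ne hXY
  obtain rfl : i = j := by
    by_contra h
    exact hi ((hX.1 i h).trans (hY.1 i h).symm)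
  obtain rfl : i = k := by
    by_contra h
    exact hi ((hX'.1 i h).trans (hY'.1 i h).symm)
  obtain ⟨rfl, rfl⟩ := Submodule.eq_inf_and_eq_sup_of_pencil hM hN (X.2 i) (Y.2 i) hi
    hX.2.1 hX.2.2 hY.2.1 hY.2.2
  obtain ⟨rfl, rfl⟩ := Submodule.eq_inf_and_eq_sup_of_pencil hM' hN' (X.2 i) (Y.2 i) hi
    hX'.2.1 hX'.2.2 hY'.2.1 hY'.2.2
  ext Z
  refine and_congr_left fun _ => forall₂_congr fun l hl => ?_
  rw [← hX.1 l hl, ← hX'.1 l hl]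

lemma IsSegreLine.exists_third {L : Set (SegrePts K U)} (hL : IsSegreLine L)
    {X Y : SegrePts K U} (hXY : X ≠ Y) (hX : X ∈ L) (hY : Y ∈ L) :
    ∃ Z ∈ L, Z ≠ X ∧ Z ≠ Y := by
  obtain ⟨j, M, N, C, hM, hN, -, rfl⟩ := hL
  obtain ⟨i, hi⟩ := SegrePts.exists_ne hXY
  obtain rfl : i = j := by
    by_contra h
    exact hi ((hX.1 i h).trans (hY.1 i h).symm)
  obtain ⟨A, hA, hMA, hAN, hAX, hAY⟩ := Submodule.exists_third_of_pencil hM hN (X.2 i) (Y.2 i) hi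
    hX.2.1 hX.2.2 hY.2.2
  obtain ⟨Z, rfl, hZ⟩ := C.exists_update i A hA
  exact ⟨Z, ⟨hZ, hMA, hAN⟩, fun h => hAX (h ▸ rfl), fun h => hAY (h ▸ rfl)⟩

lemma IsSegreLine.exists_two (hdim : ∀ i, 1 ≤ finrank (K i) (U i)) {L : Set (SegrePts K U)}
    (hL : IsSegreLine L) : ∃ X ∈ L, ∃ Y ∈ L, X ≠ Y := by
  obtain ⟨j, M, N, C, hM, hN, hMN, rfl⟩ := hL
  obtain ⟨A, B, hA, hB, hAB, hMA, hAN, hMB, hBN⟩ :=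
    Submodule.exists_two_of_pencil (hdim j) hM hN hMN
  obtain ⟨X, rfl, hX⟩ := C.exists_update j A hA
  obtain ⟨Y, rfl, hY⟩ := C.exists_update j B hB
  exact ⟨X, ⟨hX, hMA, hAN⟩, Y, ⟨hY, hMB, hBN⟩, fun h => hAB (h ▸ rfl)⟩

lemma exists_relVia_segreOpp_iff {X Y : SegrePts K U} :
    (∃ Z, RelVia SegreOpp X Y Z) ↔ SegreCollinear X Y := by
  constructor
  · rintro ⟨Z, hZ⟩
    obtain ⟨hXY, -, -, L, hL, hX, hY, -⟩ := relVia_segreOpp_iff.1 hZ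
    exact ⟨hXY, L, hL, hX, hY⟩
  · rintro ⟨hXY, L, hL, hX, hY⟩
    obtain ⟨Z, hZ, hZX, hZY⟩ := hL.exists_third hXY hX hY
    exact ⟨Z, relVia_segreOpp_iff.2 ⟨hXY, hZX, hZY, L, hL, hX, hY, hZ⟩⟩

lemma IsSegreLine.eq_setOf_relVia {L : Set (SegrePts K U)} (hL : IsSegreLine L)
    {X Y : SegrePts K U} (hXY : X ≠ Y) (hX : X ∈ L) (hY : Y ∈ L) :
    L = {Z | Z = X ∨ Z = Y ∨ RelVia SegreOpp X Y Z} := by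
  ext Z
  constructor
  · intro hZ
    by_cases h1 : Z = X
    · exact Or.inl h1
    by_cases h2 : Z = Y
    · exact Or.inr (Or.inl h2)
    exact Or.inr (Or.inr (relVia_segreOpp_iff.2 ⟨hXY, h1, h2, L, hL, hX, hY, hZ⟩))
  · rintro (rfl | rfl | h)
    · exact hX
    · exact hY
    · obtain ⟨-, -, -, L', hL', hX', hY', hZ'⟩ := relVia_segreOpp_iff.1 h
      rwa [hL.eq_of_mem hL' hXY hX hY hX' hY']

/-- Lines expressed in terms of the relation `SegreOpp` alone. -/
lemma isSegreLine_iff (hdim : ∀ i, 1 ≤ finrank (K i) (U i)) {L : Set (SegrePts K U)} :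
    IsSegreLine L ↔ ∃ X Y, (∃ Z, RelVia SegreOpp X Y Z) ∧
      L = {Z | Z = X ∨ Z = Y ∨ RelVia SegreOpp X Y Z} := by
  constructor
  · intro hL
    obtain ⟨X, hX, Y, hY, hXY⟩ := hL.exists_two hdim
    exact ⟨X, Y, exists_relVia_segreOpp_iff.2 ⟨hXY, L, hL, hX, hY⟩,
      hL.eq_setOf_relVia hXY hX hY⟩
  · rintro ⟨X, Y, h, rfl⟩
    obtain ⟨hXY, L, hL, hX, hY⟩ := exists_relVia_segreOpp_iff.1 h
    rwa [← hL.eq_setOf_relVia hXY hX hY]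

section Distance

variable [Fintype I]

lemma segreOpp_iff_segreDist {X Y : SegrePts K U} :
    SegreOpp X Y ↔ segreDist X Y = ∑ i, finrank (K i) (U i) := by
  rw [segreDist, Finset.sum_eq_sum_iff_of_le fun _ _ => Nat.sub_le _ _]
  refine forall_congr' fun i => ?_
  have := X.finrank_inf_le Y i
  rw [SegrePts.isCompl_iff_disjoint, disjoint_iff, ← Submodule.finrank_eq_zero (R := K i)]
  simp only [Finset.mem_univ, forall_const]
  have h1 := X.2 i
  have : finrank (K i) (U i) - finrank (K i) (X.1 i ⊓ Y.1 i : Submodule (K i) (U i × U i)) =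
    finrank (K i) (U i) ↔ finrank (K i) (X.1 i ⊓ Y.1 i : Submodule (K i) (U i × U i)) = 0 := by
      omega
  exact this.symm

lemma SegreCollinear.segreDist_le {X X' : SegrePts K U} (h : SegreCollinear X X')
    (Y : SegrePts K U) : segreDist X Y ≤ segreDist X' Y + 1 := by
  classical
  obtain ⟨-, L, ⟨j, M, N, C, hM, hN, -, rfl⟩, hX, hX'⟩ := h
  have hj := Submodule.finrank_inf_le_of_pencil (Y.1 j) hM (X'.2 j) hX'.2.1 hX.2.1
  rw [segreDist, segreDist, ← Finset.add_sum_erase _ _ (Finset.mem_univ j),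
    ← Finset.add_sum_erase _ _ (Finset.mem_univ j)]
  have he : ∀ i ∈ Finset.univ.erase j,
      finrank (K i) (U i) - finrank (K i) (X.1 i ⊓ Y.1 i : Submodule (K i) (U i × U i)) =
      finrank (K i) (U i) - finrank (K i) (X'.1 i ⊓ Y.1 i : Submodule (K i) (U i × U i)) := by
    intro i hi
    have hij := Finset.ne_of_mem_erase hi
    rw [hX.1 i hij, hX'.1 i hij]
  rw [Finset.sum_congr rfl he]
  omega

lemma exists_segreCollinear_closer {X Y : SegrePts K U} (hXY : X ≠ Y) :
    ∃ X', SegreCollinear X X' ∧ segreDist X' Y + 1 ≤ segreDist X Y := by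
  classical
  obtain ⟨j, hj⟩ := SegrePts.exists_ne hXY
  obtain ⟨M, N, A, hM, hN, hA, hMX, hXN, hMA, hAN, hAX, hr⟩ :=
    Submodule.exists_pencil_closer (X.2 j) (Y.2 j) hj
  obtain ⟨X', rfl, hX'⟩ := X.exists_update j A hA
  refine ⟨X', ⟨fun h => hAX (h ▸ rfl), _, ⟨j, M, N, X, hM, hN, hMX.trans hXN, rfl⟩,
    ⟨fun _ _ => rfl, hMX, hXN⟩, ⟨hX', hMA, hAN⟩⟩, ?_⟩
  rw [segreDist, segreDist, ← Finset.add_sum_erase _ _ (Finset.mem_univ j),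
    ← Finset.add_sum_erase _ _ (Finset.mem_univ j)]
  have he : ∀ i ∈ Finset.univ.erase j,
      finrank (K i) (U i) - finrank (K i) (X'.1 i ⊓ Y.1 i : Submodule (K i) (U i × U i)) =
      finrank (K i) (U i) - finrank (K i) (X.1 i ⊓ Y.1 i : Submodule (K i) (U i × U i)) := by
    intro i hi
    rw [hX' i (Finset.ne_of_mem_erase hi)]
  rw [Finset.sum_congr rfl he]
  have := X'.finrank_inf_le Y j
  omega

end Distance

section Maps

variable {I' : Type*} {K' U' : I' → Type*} [∀ i, DivisionRing (K' i)]
    [∀ i, AddCommGroup (U' i)] [∀ i, Module (K' i) (U' i)]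
    [∀ i, FiniteDimensional (K' i) (U' i)]

lemma segreDist_map_le [Fintype I] [Fintype I'] {f : SegrePts K U → SegrePts K' U'}
    (hf : ∀ X Y, SegreCollinear X Y → SegreCollinear (f X) (f Y)) (X Y : SegrePts K U) :
    segreDist (f X) (f Y) ≤ segreDist X Y := by
  induction hn : segreDist X Y using Nat.strong_induction_on generalizing X with
  | _ n ih =>
    by_cases hXY : X = Y
    · subst hXY
      have : segreDist (f X) (f X) = 0 :=
        Finset.sum_eq_zero fun i _ => by rw [inf_idem, (f X).2 i, Nat.sub_self]
      omega
    · obtain ⟨X', hc, hd⟩ := exists_segreCollinear_closer hXY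
      have h1 := ih (segreDist X' Y) (by omega) X' rfl
      have h2 := (hf X X' hc).segreDist_le (f Y)
      omega

/-- Isomorphisms of collinearity graphs preserve opposite points. -/
lemma segreOpp_iff_of_segreCollinear_iff [Fintype I] [Fintype I']
    (e : SegrePts K U ≃ SegrePts K' U')
    (he : ∀ X Y, SegreCollinear X Y ↔ SegreCollinear (e X) (e Y)) (X Y : SegrePts K U) :
    SegreOpp X Y ↔ SegreOpp (e X) (e Y) := by
  have hd : ∀ X Y, segreDist (e X) (e Y) = segreDist X Y := fun X Y => by
    refine le_antisymm (segreDist_map_le (fun X Y => (he X Y).1) X Y) ?_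
    have := segreDist_map_le (f := e.symm) (fun X Y h => (he _ _).2 (by simpa using h)) (e X) (e Y)
    simpa using this
  have hsum : ∑ i, finrank (K i) (U i) = ∑ i, finrank (K' i) (U' i) := by
    obtain ⟨Z⟩ := nonempty_segrePts (K := K) (U := U)
    obtain ⟨W, hW⟩ := Z.exists_opp
    obtain ⟨W', hW'⟩ := (e Z).exists_opp
    refine le_antisymm ?_ ?_
    · rw [← segreOpp_iff_segreDist.1 hW, ← hd]
      exact segreDist_le_sum _ _
    · rw [← segreOpp_iff_segreDist.1 hW', ← e.apply_symm_apply W', hd]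
      exact segreDist_le_sum _ _
  rw [segreOpp_iff_segreDist, segreOpp_iff_segreDist, hd, hsum]

lemma segreCollinear_iff_of_segreOpp_iff (e : SegrePts K U ≃ SegrePts K' U')
    (he : ∀ X Y, SegreOpp X Y ↔ SegreOpp (e X) (e Y)) (X Y : SegrePts K U) :
    SegreCollinear X Y ↔ SegreCollinear (e X) (e Y) := by
  simp only [← exists_relVia_segreOpp_iff, relVia_equiv_iff e he,
    e.surjective.exists]

lemma isSegreLine_image_of_segreOpp_iff (hdim : ∀ i, 1 ≤ finrank (K i) (U i))
    (hdim' : ∀ i, 1 ≤ finrank (K' i) (U' i)) (e : SegrePts K U ≃ SegrePts K' U')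
    (he : ∀ X Y, SegreOpp X Y ↔ SegreOpp (e X) (e Y)) {L : Set (SegrePts K U)}
    (hL : IsSegreLine L) : IsSegreLine (e '' L) := by
  obtain ⟨X, Y, ⟨Z, hZ⟩, rfl⟩ := (isSegreLine_iff hdim).1 hL
  refine (isSegreLine_iff hdim').2 ⟨e X, e Y, ⟨e Z, (relVia_equiv_iff e he _ _ _).2 hZ⟩, ?_⟩
  ext W
  obtain ⟨W, rfl⟩ := e.surjective W
  simp [relVia_equiv_iff e he]

lemma isSegreCollineation_iff (hdim : ∀ i, 1 ≤ finrank (K i) (U i))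
    (hdim' : ∀ i, 1 ≤ finrank (K' i) (U' i)) [Fintype I] [Fintype I']
    (e : SegrePts K U ≃ SegrePts K' U') :
    IsSegreCollineation e ↔ ∀ X Y, SegreOpp X Y ↔ SegreOpp (e X) (e Y) := by
  constructor
  · rintro ⟨-, h1, h2⟩
    refine segreOpp_iff_of_segreCollinear_iff e fun X Y => ⟨?_, ?_⟩
    · rintro ⟨hXY, L, hL, hX, hY⟩
      exact ⟨e.injective.ne hXY, _, h1 L hL, Set.mem_image_of_mem e hX, Set.mem_image_of_mem e hY⟩
    · rintro ⟨hXY, L, hL, hX, hY⟩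
      exact ⟨fun h => hXY (h ▸ rfl), _, h2 L hL, hX, hY⟩
  · intro he
    refine ⟨e.bijective, fun L hL => isSegreLine_image_of_segreOpp_iff hdim hdim' e he hL,
      fun L hL => ?_⟩
    have := isSegreLine_image_of_segreOpp_iff hdim' hdim e.symm
      (fun X Y => by simpa using (he (e.symm X) (e.symm Y)).symm) hL
    rwa [e.symm.image_eq_preimage_symm, e.symm_symm] at this

end Maps

end Segre

section ProjectiveLine

open Module

lemma Distant.isPoint_left {R : Type*} [Ring R] {p q : Submodule R (R × R)} (h : Distant p q) :
    IsPoint R p := by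
  obtain ⟨g, hp, -⟩ := h
  exact ⟨g, hp⟩

lemma adjacent_iff_relVia {R : Type*} [Ring R] (p q : PL R) :
    Adjacent p.1 q.1 ↔ ∃ r, RelVia (fun x y : PL R => Distant x.1 y.1) p q r := by
  have par : ∀ r p : PL R, Parallel r.1 p.1 ↔ ∀ x : PL R, Distant x.1 r.1 → Distant x.1 p.1 :=
    fun r p => ⟨fun h x hx => h hx, fun h x hx => h ⟨x, hx.isPoint_left⟩ hx⟩
  have cov : ∀ r : PL R, DistantSet r.1 ⊆ DistantSet p.1 ∪ DistantSet q.1 ↔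
      ∀ x : PL R, Distant x.1 r.1 → Distant x.1 p.1 ∨ Distant x.1 q.1 :=
    fun r => ⟨fun h x hx => h hx, fun h x hx => h ⟨x, hx.isPoint_left⟩ hx⟩
  constructor
  · rintro ⟨r, hr, h1, h2, h3⟩
    exact ⟨⟨r, hr⟩, mt (par ⟨r, hr⟩ p).2 h1, mt (par ⟨r, hr⟩ q).2 h2, (cov ⟨r, hr⟩).1 h3⟩
  · rintro ⟨r, h1, h2, h3⟩
    exact ⟨r.1, r.2, mt (par r p).1 h1, mt (par r q).1 h2, (cov r).2 h3⟩

lemma isUnit_matrix_fin_two {R : Type*} [Ring R] {a b c d a' b' c' d' : R}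
    (h₁ : a * a' + b * c' = 1) (h₂ : a * b' + b * d' = 0)
    (h₃ : c * a' + d * c' = 0) (h₄ : c * b' + d * d' = 1)
    (k₁ : a' * a + b' * c = 1) (k₂ : a' * b + b' * d = 0)
    (k₃ : c' * a + d' * c = 0) (k₄ : c' * b + d' * d = 1) :
    IsUnit !![a, b; c, d] := by
  refine ⟨⟨!![a, b; c, d], !![a', b'; c', d'], ?_, ?_⟩, rfl⟩
  · rw [Matrix.mul_fin_two, h₁, h₂, h₃, h₄, Matrix.one_fin_two]
  · rw [Matrix.mul_fin_two, k₁, k₂, k₃, k₄, Matrix.one_fin_two]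

/-- The entries of the inverse of an endomorphism of `U × U` given by a matrix. -/
lemma exists_inverse_entries_of_isCompl {K U : Type*} [DivisionRing K] [AddCommGroup U]
    [Module K U] [FiniteDimensional K U] {a b c d : EndOp K U}
    (h : IsCompl (LinearMap.range ((unop a).prod (unop b)))
      (LinearMap.range ((unop c).prod (unop d)))) :
    ∃ a' b' c' d' : EndOp K U,
      (a * a' + b * c' = 1 ∧ a * b' + b * d' = 0 ∧ c * a' + d * c' = 0 ∧ c * b' + d * d' = 1) ∧
      (a' * a + b' * c = 1 ∧ a' * b + b' * d = 0 ∧ c' * a + d' * c = 0 ∧ c' * b + d' * d = 1) := by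
  let T : Module.End K (U × U) :=
    ((unop a).prod (unop b)).coprod ((unop c).prod (unop d))
  have hT : Function.Surjective T := by
    rw [← LinearMap.range_eq_top, LinearMap.range_coprod]
    exact h.sup_eq_top
  let e : (U × U) ≃ₗ[K] (U × U) :=
    LinearEquiv.ofBijective T ⟨LinearMap.injective_iff_surjective.2 hT, hT⟩
  have he : ∀ u v, e (u, v) = (unop a u + unop c v, unop b u + unop d v) := fun u v => rfl
  have hs : ∀ w, ((e.symm w).1, (e.symm w).2) = e.symm w := fun w => rfl
  have hes : ∀ w, (unop a (e.symm w).1 + unop c (e.symm w).2,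
      unop b (e.symm w).1 + unop d (e.symm w).2) = w := fun w => by
    rw [← he, hs, e.apply_symm_apply]
  have split : ∀ x y : U, e.symm (x, y) = e.symm (x, 0) + e.symm (0, y) := fun x y => by
    rw [← map_add]; simp
  have hse : ∀ u v, e.symm (unop a u + unop c v, 0) + e.symm (0, unop b u + unop d v) = (u, v) :=
    fun u v => by rw [← split, ← he, e.symm_apply_apply]
  let s : Module.End K (U × U) := e.symm.toLinearMap
  refine ⟨op (LinearMap.fst K U U ∘ₗ s ∘ₗ LinearMap.inl K U U),
    op (LinearMap.snd K U U ∘ₗ s ∘ₗ LinearMap.inl K U U),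
    op (LinearMap.fst K U U ∘ₗ s ∘ₗ LinearMap.inr K U U),
    op (LinearMap.snd K U U ∘ₗ s ∘ₗ LinearMap.inr K U U), ⟨?_, ?_, ?_, ?_⟩, ?_, ?_, ?_, ?_⟩ <;>
    refine unop_injective (LinearMap.ext fun u => ?_)
  · simpa [s] using congrArg Prod.fst (hse u 0)
  · simpa [s] using congrArg Prod.snd (hse u 0)
  · simpa [s] using congrArg Prod.fst (hse 0 u)
  · simpa [s] using congrArg Prod.snd (hse 0 u)
  · simpa [s] using congrArg Prod.fst (hes (u, 0))
  · simpa [s] using congrArg Prod.snd (hes (u, 0))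
  · simpa [s] using congrArg Prod.fst (hes (0, u))
  · simpa [s] using congrArg Prod.snd (hes (0, u))

lemma isCompl_of_inverse_entries {K U : Type*} [DivisionRing K] [AddCommGroup U]
    [Module K U] {a b c d a' b' c' d' : EndOp K U}
    (h₁ : a * a' + b * c' = 1) (h₃ : c * a' + d * c' = 0)
    (k₁ : a' * a + b' * c = 1) (k₂ : a' * b + b' * d = 0)
    (k₃ : c' * a + d' * c = 0) (k₄ : c' * b + d' * d = 1) :
    IsCompl (LinearMap.range ((unop a).prod (unop b)))
      (LinearMap.range ((unop c).prod (unop d))) := by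
  have ap : ∀ {x y : EndOp K U} (_ : x = y) (u : U), unop x u = unop y u := by
    rintro x _ rfl u
    rfl
  constructor
  · rw [Submodule.disjoint_def]
    rintro _ ⟨u, rfl⟩ ⟨v, hv⟩
    have e1 : unop c v = unop a u := congrArg Prod.fst hv
    have e2 : unop d v = unop b u := congrArg Prod.snd hv
    have hu : u = 0 := by
      have f1 : unop a' (unop a u) + unop c' (unop b u) = u := by simpa using ap h₁ u
      have f3 : unop a' (unop c v) + unop c' (unop d v) = 0 := by simpa using ap h₃ v
      rw [← f1, ← e1, ← e2, f3]
    simp [hu]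
  · rw [codisjoint_iff_le_sup]
    rintro ⟨x, y⟩ -
    have f1 : unop a (unop a' x) + unop c (unop b' x) = x := by simpa using ap k₁ x
    have f2 : unop b (unop a' x) + unop d (unop b' x) = 0 := by simpa using ap k₂ x
    have f3 : unop a (unop c' y) + unop c (unop d' y) = 0 := by simpa using ap k₃ y
    have f4 : unop b (unop c' y) + unop d (unop d' y) = y := by simpa using ap k₄ y
    refine Submodule.mem_sup.2 ⟨_, ⟨unop a' x + unop c' y, rfl⟩, _, ⟨unop b' x + unop d' y, rfl⟩, ?_⟩
    refine Prod.ext ?_ ?_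
    · calc unop a (unop a' x + unop c' y) + unop c (unop b' x + unop d' y)
          = (unop a (unop a' x) + unop c (unop b' x)) +
            (unop a (unop c' y) + unop c (unop d' y)) := by simp only [map_add]; abel
        _ = x := by rw [f1, f3, add_zero]
    · calc unop b (unop a' x + unop c' y) + unop d (unop b' x + unop d' y)
          = (unop b (unop a' x) + unop d (unop b' x)) +
            (unop b (unop c' y) + unop d (unop d' y)) := by simp only [map_add]; abel
        _ = y := by rw [f2, f4, zero_add]

variable {I : Type*} {K U : I → Type*} [∀ i, DivisionRing (K i)]
    [∀ i, AddCommGroup (U i)] [∀ i, Module (K i) (U i)] [∀ i, FiniteDimensional (K i) (U i)]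

/-- Under the canonical bijection, distant points correspond to opposite points. -/
lemma distant_iff_segreOpp {Ψ : PL (Π i, EndOp (K i) (U i)) → SegrePts K U}
    (hΨ : ∀ (p : PL (Π i, EndOp (K i) (U i))) (a b : Π i, EndOp (K i) (U i)),
      p.1 = Submodule.span (Π i, EndOp (K i) (U i)) {(a, b)} →
      ∀ i, (Ψ p).1 i = LinearMap.range ((unop (a i)).prod (unop (b i))))
    (p q : PL (Π i, EndOp (K i) (U i))) : Distant p.1 q.1 ↔ SegreOpp (Ψ p) (Ψ q) := by
  constructor
  · rintro ⟨g, hp, hq⟩ i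
    rw [hΨ p _ _ hp i, hΨ q _ _ hq i]
    have h1 : ∀ k l, (g.val * g⁻¹.val) k l i =
        (1 : Matrix (Fin 2) (Fin 2) (Π i, EndOp (K i) (U i))) k l i := fun k l => by
      rw [g.mul_inv]
    have h2 : ∀ k l, (g⁻¹.val * g.val) k l i =
        (1 : Matrix (Fin 2) (Fin 2) (Π i, EndOp (K i) (U i))) k l i := fun k l => by
      rw [g.inv_mul]
    simp only [Matrix.mul_apply, Fin.sum_univ_two, Pi.add_apply, Pi.mul_apply] at h1 h2
    exact isCompl_of_inverse_entries (by simpa using h1 0 0) (by simpa using h1 1 0)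
      (by simpa using h2 0 0) (by simpa using h2 0 1) (by simpa using h2 1 0)
      (by simpa using h2 1 1)
  · intro h
    obtain ⟨g, hp⟩ := p.2
    obtain ⟨g', hq⟩ := q.2
    have hc : ∀ i, IsCompl (LinearMap.range ((unop (g.val 0 0 i)).prod (unop (g.val 0 1 i))))
        (LinearMap.range ((unop (g'.val 0 0 i)).prod (unop (g'.val 0 1 i)))) := fun i => by
      rw [← hΨ p _ _ hp i, ← hΨ q _ _ hq i]
      exact h i
    choose a' b' c' d' h1 h2 using fun i => exists_inverse_entries_of_isCompl (hc i)
    obtain ⟨u, hu⟩ := isUnit_matrix_fin_two (a := g.val 0 0) (b := g.val 0 1) (c := g'.val 0 0)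
      (d := g'.val 0 1) (a' := a') (b' := b') (c' := c') (d' := d')
      (funext fun i => (h1 i).1) (funext fun i => (h1 i).2.1)
      (funext fun i => (h1 i).2.2.1) (funext fun i => (h1 i).2.2.2)
      (funext fun i => (h2 i).1) (funext fun i => (h2 i).2.1)
      (funext fun i => (h2 i).2.2.1) (funext fun i => (h2 i).2.2.2)
    exact ⟨u, by simpa [hu] using hp, by simpa [hu] using hq⟩

lemma adjacent_iff_segreCollinear (Ψ : PL (Π i, EndOp (K i) (U i)) ≃ SegrePts K U)
    (hΨ : ∀ (p : PL (Π i, EndOp (K i) (U i))) (a b : Π i, EndOp (K i) (U i)),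
      p.1 = Submodule.span (Π i, EndOp (K i) (U i)) {(a, b)} →
      ∀ i, (Ψ p).1 i = LinearMap.range ((unop (a i)).prod (unop (b i))))
    (p q : PL (Π i, EndOp (K i) (U i))) : Adjacent p.1 q.1 ↔ SegreCollinear (Ψ p) (Ψ q) := by
  rw [adjacent_iff_relVia, ← exists_relVia_segreOpp_iff, Ψ.surjective.exists]
  simp only [relVia_equiv_iff Ψ (distant_iff_segreOpp hΨ)]

end ProjectiveLine

/-- Let `R = Π_{i=1}^m End_{K_i}(U_i)` and
`R' = Π_{j=1}^{m'} End_{K'_j}(U'_j)` (all dimensions finite and `≥ 1`), with associated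
product spaces `𝔐`, `𝔐'` and canonical bijections `Ψ`, `Ψ'`.  For a mapping
`φ : ℙ(R) → ℙ(R')` the following are equivalent: (1) `φ` is a `△`-isomorphism;
(2) `φ` is a `∼`-isomorphism; (3) `X ↦ Ψ'(φ(Ψ⁻¹ X))` is a collineation `𝔐 → 𝔐'`. -/
theorem stmt_15 {m m' : ℕ} (hm : 0 < m) (hm' : 0 < m')
    {K U : Fin m → Type*} [∀ i, DivisionRing (K i)] [∀ i, AddCommGroup (U i)]
    [∀ i, Module (K i) (U i)] [∀ i, FiniteDimensional (K i) (U i)]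
    {K' U' : Fin m' → Type*} [∀ j, DivisionRing (K' j)] [∀ j, AddCommGroup (U' j)]
    [∀ j, Module (K' j) (U' j)] [∀ j, FiniteDimensional (K' j) (U' j)]
    (hdim : ∀ i, 1 ≤ Module.finrank (K i) (U i))
    (hdim' : ∀ j, 1 ≤ Module.finrank (K' j) (U' j))
    (Ψ : PL (Π i, EndOp (K i) (U i)) ≃ SegrePts K U)
    (hΨ : ∀ (p : PL (Π i, EndOp (K i) (U i))) (a b : Π i, EndOp (K i) (U i)),
      p.1 = Submodule.span (Π i, EndOp (K i) (U i)) {(a, b)} →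
      ∀ i, (Ψ p).1 i = LinearMap.range ((unop (a i)).prod (unop (b i))))
    (Ψ' : PL (Π j, EndOp (K' j) (U' j)) ≃ SegrePts K' U')
    (hΨ' : ∀ (p' : PL (Π j, EndOp (K' j) (U' j))) (a b : Π j, EndOp (K' j) (U' j)),
      p'.1 = Submodule.span (Π j, EndOp (K' j) (U' j)) {(a, b)} →
      ∀ j, (Ψ' p').1 j = LinearMap.range ((unop (a j)).prod (unop (b j))))
    (φ : PL (Π i, EndOp (K i) (U i)) → PL (Π j, EndOp (K' j) (U' j))) :
    ((Function.Bijective φ ∧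
        ∀ p q, (Distant p.1 q.1 ↔ Distant (φ p).1 (φ q).1)) ↔
      (Function.Bijective φ ∧
        ∀ p q, (Adjacent p.1 q.1 ↔ Adjacent (φ p).1 (φ q).1))) ∧
    ((Function.Bijective φ ∧
        ∀ p q, (Distant p.1 q.1 ↔ Distant (φ p).1 (φ q).1)) ↔
      IsSegreCollineation (fun X => Ψ' (φ (Ψ.symm X)))) := by
  have hD := distant_iff_segreOpp hΨ
  have hD' := distant_iff_segreOpp hΨ'
  have hA := adjacent_iff_segreCollinear Ψ hΨ
  have hA' := adjacent_iff_segreCollinear Ψ' hΨ'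
  have key : ∀ hφ : Function.Bijective φ,
      ((∀ p q, (Distant p.1 q.1 ↔ Distant (φ p).1 (φ q).1)) ↔
        (∀ p q, (Adjacent p.1 q.1 ↔ Adjacent (φ p).1 (φ q).1))) ∧
      ((∀ p q, (Distant p.1 q.1 ↔ Distant (φ p).1 (φ q).1)) ↔
        IsSegreCollineation (fun X => Ψ' (φ (Ψ.symm X)))) := by
    intro hφ
    obtain ⟨e, he⟩ : ∃ e : SegrePts K U ≃ SegrePts K' U', ∀ X, e X = Ψ' (φ (Ψ.symm X)) :=
      ⟨Ψ.symm.trans ((Equiv.ofBijective φ hφ).trans Ψ'), fun X => rfl⟩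
    have hopp : (∀ p q, (Distant p.1 q.1 ↔ Distant (φ p).1 (φ q).1)) ↔
        ∀ X Y, SegreOpp X Y ↔ SegreOpp (e X) (e Y) := by
      simp only [hD, hD', he, Ψ.surjective.forall, Ψ.symm_apply_apply]
    have hcol : (∀ p q, (Adjacent p.1 q.1 ↔ Adjacent (φ p).1 (φ q).1)) ↔
        ∀ X Y, SegreCollinear X Y ↔ SegreCollinear (e X) (e Y) := by
      simp only [hA, hA', he, Ψ.surjective.forall, Ψ.symm_apply_apply]
    rw [hopp, hcol, ← funext he, isSegreCollineation_iff hdim hdim']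
    exact ⟨⟨segreCollinear_iff_of_segreOpp_iff e, segreOpp_iff_of_segreCollinear_iff e⟩, Iff.rfl⟩
  refine ⟨and_congr_right fun hφ => (key hφ).1, fun h => (key h.1).2.1 h.2, fun h => ?_⟩
  have hφ : Function.Bijective φ := by
    have := (Ψ'.symm.bijective.comp h.1).comp Ψ.bijective
    simpa [Function.comp_def] using this
  exact ⟨hφ, (key hφ).2.2 h⟩
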